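/- Let σ_sc denote the semicircle distribution on [−√2, √2] with density (1/π)√(2−x²), and define Ψ*(x) = ∫ log|x−t| σ_sc(dt). Then Ψ*(x) = x²/2 − 1/2 − (log 2)/2 for |x| ≤ √2, and Ψ*(x) = x²/2 − 1/2 − log 2 − (|x|/2)√(x²−2} + log(|x| + √(x²−2)) for |x| > √2. In particular Ψ*(x) − x²/2 ≤ −1/2 − (log 2)/2 for all x. -/

import Mathlib

open Real MeasureTheory

lemma iteratedDeriv_two_log_mul_sq (w : ℂ) (hw : w ≠ 0) :
    iteratedDeriv 2 (fun z : ℂ ↦ (Complex.log w + Complex.log (1 - z / w)) * (z ^ 2 - 1) ^ 2) 0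
      = -(w⁻¹ ^ 2) - 4 * Complex.log w := by
  have hslit : ∀ᶠ z : ℂ in nhds 0, 1 - z / w ∈ Complex.slitPlane := by
    have hc : ContinuousAt (fun z : ℂ ↦ 1 - z / w) 0 := by fun_prop
    exact hc.eventually (Complex.isOpen_slitPlane.mem_nhds (by simp))
  have hlog : ∀ z : ℂ, 1 - z / w ∈ Complex.slitPlane →
      HasDerivAt (fun z : ℂ ↦ Complex.log w + Complex.log (1 - z / w))
        (-(1 / w) / (1 - z / w)) z := fun z hz ↦
    ((((hasDerivAt_id z).div_const w).const_sub 1).clog hz).const_add _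
  have hpoly : ∀ z : ℂ, HasDerivAt (fun z : ℂ ↦ (z ^ 2 - 1) ^ 2) (4 * z * (z ^ 2 - 1)) z := by
    intro z
    refine ((((hasDerivAt_id z).pow 2).sub_const 1).pow 2).congr_deriv ?_
    simp
    ring
  have hderiv : deriv (fun z : ℂ ↦ (Complex.log w + Complex.log (1 - z / w)) * (z ^ 2 - 1) ^ 2)
      =ᶠ[nhds 0] fun z ↦ -(1 / w) / (1 - z / w) * (z ^ 2 - 1) ^ 2
        + (Complex.log w + Complex.log (1 - z / w)) * (4 * z * (z ^ 2 - 1)) := by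
    filter_upwards [hslit] with z hz
    exact ((hlog z hz).mul (hpoly z)).deriv
  rw [iteratedDeriv_succ, iteratedDeriv_one, hderiv.deriv_eq]
  have h1 : HasDerivAt (fun z : ℂ ↦ -(1 / w) / (1 - z / w)) (-(1 / w) * (1 / w)) 0 := by
    refine ((hasDerivAt_const (0 : ℂ) (-(1 / w))).div
      (((hasDerivAt_id (0 : ℂ)).div_const w).const_sub 1) (by simp)).congr_deriv ?_
    simp
  have h2 : HasDerivAt (fun z : ℂ ↦ 4 * z * (z ^ 2 - 1)) (-4) 0 := by
    refine (((hasDerivAt_id (0 : ℂ)).const_mul 4).mul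
      (((hasDerivAt_id (0 : ℂ)).pow 2).sub_const 1)).congr_deriv ?_
    simp
  refine (((h1.mul (hpoly 0)).add ((hlog 0 (by simp)).mul h2)).congr_deriv ?_).deriv
  simp
  ring

lemma integral_log_norm_circleMap_sub_mul_sin_sq_of_one_lt {w : ℂ} (hw : 1 < ‖w‖) :
    ∫ θ in 0..2 * π, log ‖circleMap 0 1 θ - w‖ * sin θ ^ 2
      = π * (log ‖w‖ + (w⁻¹ ^ 2).re / 4) := by
  have hw0 : w ≠ 0 := norm_pos_iff.mp (by linarith)
  set F : ℂ → ℂ := fun z ↦ (Complex.log w + Complex.log (1 - z / w)) * (z ^ 2 - 1) ^ 2 with hF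
  have hslit : ∀ z ∈ Metric.closedBall (0 : ℂ) 1, 1 - z / w ∈ Complex.slitPlane := by
    intro z hz
    rw [sub_eq_add_neg]
    apply Complex.mem_slitPlane_of_norm_lt_one
    rw [norm_neg, norm_div, div_lt_one (by linarith)]
    exact (mem_closedBall_zero_iff.mp hz).trans_lt hw
  have hdiff : DifferentiableOn ℂ F (Metric.closedBall 0 1) := by
    intro z hz
    have := hslit z hz
    apply DifferentiableAt.differentiableWithinAt
    fun_prop (disch := assumption)
  have hcauchy := (hdiff.mono Metric.closure_ball_subset_closedBall).diffContOnCl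
    |>.circleIntegral_one_div_sub_center_pow_smul one_pos 2
  rw [iteratedDeriv_two_log_mul_sq w hw0] at hcauchy
  have hint : IntervalIntegrable (fun θ ↦ deriv (circleMap 0 1) θ •
      ((1 / (circleMap 0 1 θ - 0) ^ (2 + 1)) • F (circleMap 0 1 θ))) volume 0 (2 * π) := by
    apply Continuous.intervalIntegrable
    simp only [deriv_circleMap]
    have hFc : Continuous fun θ ↦ F (circleMap 0 1 θ) :=
      hdiff.continuousOn.comp_continuous (continuous_circleMap 0 1)
        (fun θ ↦ circleMap_mem_closedBall 0 zero_le_one θ)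
    have : ∀ θ, (circleMap 0 1 θ - 0) ^ (2 + 1) ≠ 0 := fun θ ↦ by simp
    exact ((continuous_circleMap 0 1).mul continuous_const).smul
      ((continuous_const.div (by fun_prop) this).smul hFc)
  have hpt : ∀ θ : ℝ, log ‖circleMap 0 1 θ - w‖ * sin θ ^ 2 = Complex.reCLM ((Complex.I / 4) *
      (deriv (circleMap 0 1) θ •
      ((1 / (circleMap 0 1 θ - 0) ^ (2 + 1)) • F (circleMap 0 1 θ)))) := by
    intro θ
    set z := circleMap 0 1 θ with hz
    have hz0 : z ≠ 0 := by simp [hz]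
    have hs := hslit z (circleMap_mem_closedBall 0 zero_le_one θ)
    have hzs : (z ^ 2 - 1) ^ 2 / z ^ 2 = ((-4 * sin θ ^ 2 : ℝ) : ℂ) := by
      have h1 : z = Complex.cos θ + Complex.sin θ * Complex.I := by
        simp [hz, circleMap, Complex.exp_mul_I]
      have h2 : z ^ 2 - 1 = z * (2 * Complex.sin θ * Complex.I) := by
        rw [h1]
        linear_combination Complex.sin_sq_add_cos_sq θ
          - Complex.sin θ ^ 2 * Complex.I_sq
      rw [h2, mul_pow, mul_div_cancel_left₀ _ (pow_ne_zero 2 hz0)]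
      push_cast
      linear_combination 4 * Complex.sin θ ^ 2 * Complex.I_sq
    have hre : (Complex.log w + Complex.log (1 - z / w)).re = log ‖z - w‖ := by
      rw [Complex.add_re, Complex.log_re, Complex.log_re, ← Real.log_mul (by simpa using hw0)
        (by simpa using Complex.slitPlane_ne_zero hs), ← norm_mul, ← norm_neg]
      congr 2
      field_simp
      ring
    have : (Complex.I / 4) * (deriv (circleMap 0 1) θ • ((1 / (z - 0) ^ (2 + 1)) • F z))
        = ((sin θ ^ 2 : ℝ) : ℂ) * (Complex.log w + Complex.log (1 - z / w)) := by
      rw [deriv_circleMap, ← hz]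
      have : Complex.I / 4 * ((z * Complex.I) • ((1 / (z - 0) ^ (2 + 1)) • F z))
        = (Complex.I ^ 2 / 4) * ((z ^ 2 - 1) ^ 2 / z ^ 2) *
          (Complex.log w + Complex.log (1 - z / w)) := by
        simp only [hF, smul_eq_mul, sub_zero]
        field_simp
      rw [this, hzs, Complex.I_sq]
      push_cast
      ring
    rw [this, Complex.reCLM_apply, Complex.re_ofReal_mul, hre, mul_comm]
  simp_rw [hpt]
  rw [Complex.reCLM.intervalIntegral_comp_comm (hint.const_mul _),
    intervalIntegral.integral_const_mul]
  change Complex.reCLM (_ * circleIntegral (fun z ↦ (1 / (z - 0) ^ (2 + 1)) • F z) 0 1) = _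
  rw [hcauchy]
  have : Complex.I / 4 * ((2 * π * Complex.I / (Nat.factorial 2 : ℂ)) •
      (-(w⁻¹ ^ 2) - 4 * Complex.log w)) = (π : ℝ) * (Complex.log w + w⁻¹ ^ 2 / (4 : ℝ)) := by
    rw [smul_eq_mul, Nat.factorial_two]
    push_cast
    linear_combination (π / 4 : ℂ) * (-(w⁻¹ ^ 2) - 4 * Complex.log w) * Complex.I_sq
  rw [this, Complex.reCLM_apply, Complex.re_ofReal_mul, Complex.add_re, Complex.log_re,
    Complex.div_ofReal_re]

lemma intervalIntegrable_log_norm_circleMap_sub_mul_sin_sq (w : ℂ) (a b : ℝ) :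
    IntervalIntegrable (fun θ ↦ log ‖circleMap 0 1 θ - w‖ * sin θ ^ 2) volume a b := by
  have h : CircleIntegrable (fun z ↦ log ‖z - w‖) 0 1 := circleIntegrable_log_norm_sub_const 1
  have hper : Function.Periodic (fun θ ↦ log ‖circleMap 0 1 θ - w‖) (2 * π) := fun θ ↦ by
    simp [periodic_circleMap 0 1 θ]
  have h2 : IntervalIntegrable (fun θ ↦ log ‖circleMap 0 1 θ - w‖) volume a b :=
    hper.intervalIntegrable₀ two_pi_pos.ne' h a b
  exact h2.mul_continuousOn (by fun_prop)

lemma ae_circleMap_sub_ne_zero (w : ℂ) : ∀ᵐ θ : ℝ, circleMap 0 1 θ - w ≠ 0 := by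
  have h := ((Set.countable_singleton w).preimage_circleMap 0 one_ne_zero).ae_notMem volume
  filter_upwards [h] with θ hθ
  simpa [sub_eq_zero] using hθ

lemma norm_sub_le_norm_sub_smul {z w : ℂ} (hz : ‖z‖ = 1) (hw : ‖w‖ = 1) {r : ℝ} (hr : 1 ≤ r) :
    ‖z - w‖ ≤ ‖z - r * w‖ := by
  have hz2 : z.re ^ 2 + z.im ^ 2 = 1 := by
    rw [← Complex.sq_norm_sub_sq_re z, hz]; ring
  have hw2 : w.re ^ 2 + w.im ^ 2 = 1 := by
    rw [← Complex.sq_norm_sub_sq_re w, hw]; ring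
  have hin : z.re * w.re + z.im * w.im ≤ 1 := by
    nlinarith [sq_nonneg (z.re - w.re), sq_nonneg (z.im - w.im)]
  apply le_of_sq_le_sq _ (norm_nonneg _)
  rw [← Complex.normSq_eq_norm_sq, ← Complex.normSq_eq_norm_sq, Complex.normSq_apply,
    Complex.normSq_apply]
  simp only [Complex.sub_re, Complex.sub_im, Complex.re_ofReal_mul, Complex.im_ofReal_mul]
  rw [← sub_nonneg]
  calc (0 : ℝ) ≤ 2 * ((r - 1) * (1 - (z.re * w.re + z.im * w.im))) + (r - 1) ^ 2 := by
        have := mul_nonneg (sub_nonneg.mpr hr) (sub_nonneg.mpr hin)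
        positivity
    _ = _ := by linear_combination (1 - r ^ 2) * hw2

lemma integral_log_norm_circleMap_sub_mul_sin_sq {w : ℂ} (hw : 1 ≤ ‖w‖) :
    ∫ θ in 0..2 * π, log ‖circleMap 0 1 θ - w‖ * sin θ ^ 2
      = π * (log ‖w‖ + (w⁻¹ ^ 2).re / 4) := by
  rcases hw.lt_or_eq with h | h
  · exact integral_log_norm_circleMap_sub_mul_sin_sq_of_one_lt h
  have hw1 : ‖w‖ = 1 := h.symm
  have hw0 : w ≠ 0 := norm_pos_iff.mp (by linarith)
  have hae := ae_circleMap_sub_ne_zero w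
  have hmem : ∀ᶠ r : ℝ in nhdsWithin 1 (Set.Ioi 1), 1 < r ∧ r < 2 :=
    Filter.eventually_of_mem (Ioo_mem_nhdsGT one_lt_two) fun _ h ↦ h
  have hlim : Filter.Tendsto (fun r : ℝ ↦ ∫ θ in 0..2 * π,
      log ‖circleMap 0 1 θ - r * w‖ * sin θ ^ 2) (nhdsWithin 1 (Set.Ioi 1))
      (nhds (∫ θ in 0..2 * π, log ‖circleMap 0 1 θ - w‖ * sin θ ^ 2)) := by
    apply intervalIntegral.tendsto_integral_filter_of_dominated_convergence
      (fun θ ↦ |log ‖circleMap 0 1 θ - w‖ * sin θ ^ 2| + log 3)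
    · exact Filter.Eventually.of_forall fun r ↦
        (intervalIntegrable_iff.mp
          (intervalIntegrable_log_norm_circleMap_sub_mul_sin_sq _ _ _)).aestronglyMeasurable
    · filter_upwards [hmem] with r hr
      filter_upwards [hae] with θ hθ _
      have hpos := norm_pos_iff.mpr (hθ)
      have hle := norm_sub_le_norm_sub_smul (z := circleMap 0 1 θ) (by simp) hw1 hr.1.le
      have hle3 : ‖circleMap 0 1 θ - r * w‖ ≤ 3 := by
        refine (norm_sub_le _ _).trans ?_
        simp [hw1, abs_of_pos (zero_lt_one.trans hr.1)]
        linarith [hr.2]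
      have hlow := Real.log_le_log hpos hle
      have hhigh := Real.log_le_log (hpos.trans_le hle) hle3
      have hlog3 : 0 ≤ log 3 := Real.log_nonneg (by norm_num)
      have habs : |log ‖circleMap 0 1 θ - r * w‖| ≤ |log ‖circleMap 0 1 θ - w‖| + log 3 := by
        rw [abs_le]
        constructor <;>
          linarith [neg_abs_le (log ‖circleMap 0 1 θ - w‖), abs_nonneg (log ‖circleMap 0 1 θ - w‖)]
      rw [Real.norm_eq_abs, abs_mul, abs_mul, abs_of_nonneg (sq_nonneg (sin θ))]
      nlinarith [sin_sq_le_one θ, sq_nonneg (sin θ)]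
    · exact (intervalIntegrable_log_norm_circleMap_sub_mul_sin_sq _ _ _).abs.add
        intervalIntegrable_const
    · filter_upwards [hae] with θ hθ _
      have hc : ContinuousAt (fun r : ℝ ↦ log ‖circleMap 0 1 θ - r * w‖ * sin θ ^ 2) 1 := by
        have : ‖circleMap 0 1 θ - (1 : ℝ) * w‖ ≠ 0 := by simpa using hθ
        fun_prop (disch := assumption)
      simpa using hc.tendsto.mono_left nhdsWithin_le_nhds
  have hlim2 : Filter.Tendsto (fun r : ℝ ↦ ∫ θ in 0..2 * π,
      log ‖circleMap 0 1 θ - r * w‖ * sin θ ^ 2) (nhdsWithin 1 (Set.Ioi 1))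
      (nhds (π * (log ‖w‖ + (w⁻¹ ^ 2).re / 4))) := by
    have hc : ContinuousAt (fun r : ℝ ↦
        π * (log ‖(r * w : ℂ)‖ + (((r * w : ℂ)⁻¹) ^ 2).re / 4)) 1 := by
      have h1 : ((1 : ℝ) * w : ℂ) ≠ 0 := by simpa using hw0
      have h2 : ‖((1 : ℝ) * w : ℂ)‖ ≠ 0 := norm_ne_zero_iff.mpr h1
      have h3 : ContinuousAt (fun r : ℝ ↦ ((r * w : ℂ)⁻¹) ^ 2) 1 := by
        fun_prop (disch := assumption)
      have h4 := Complex.continuous_re.continuousAt.comp h3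
      have h5 : ContinuousAt (fun r : ℝ ↦ log ‖(r * w : ℂ)‖) 1 := by
        fun_prop (disch := assumption)
      exact (h5.add (h4.div_const 4)).const_mul π |>.congr (by rfl)
    have := hc.tendsto.mono_left (nhdsWithin_le_nhds (s := Set.Ioi 1))
    simp only [Complex.ofReal_one, one_mul] at this
    refine this.congr' ?_
    filter_upwards [hmem] with r hr
    rw [integral_log_norm_circleMap_sub_mul_sin_sq_of_one_lt]
    simpa [hw1, abs_of_pos (zero_lt_one.trans hr.1)] using hr.1
  exact tendsto_nhds_unique hlim hlim2

lemma image_sqrt_two_mul_cos :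
    (fun θ ↦ √2 * cos θ) '' Set.Icc 0 π = Set.Icc (-√2) (√2) := by
  have h : (fun θ ↦ √2 * cos θ) = (fun y ↦ √2 * y) ∘ cos := rfl
  rw [h, Set.image_comp, bijOn_cos.image_eq, Set.image_mul_left_Icc (by positivity) (by norm_num)]
  simp

lemma integral_log_abs_sub_semicircle_eq_integral_cos (x : ℝ) :
    ∫ t in Set.Icc (-√2) (√2), log |x - t| * (√(2 - t ^ 2) / π)
      = ∫ θ in 0..π, 2 / π * (log |x - √2 * cos θ| * sin θ ^ 2) := by
  have hinj : Set.InjOn (fun θ ↦ √2 * cos θ) (Set.Icc 0 π) := fun a ha b hb hab ↦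
    injOn_cos ha hb (mul_left_cancel₀ (by positivity) hab)
  rw [← image_sqrt_two_mul_cos, integral_image_eq_integral_abs_deriv_smul measurableSet_Icc
    (fun θ _ ↦ ((hasDerivAt_cos θ).const_mul √2).hasDerivWithinAt) hinj,
    intervalIntegral.integral_of_le pi_pos.le, ← integral_Icc_eq_integral_Ioc]
  refine setIntegral_congr_fun measurableSet_Icc fun θ hθ ↦ ?_
  have hsin := sin_nonneg_of_mem_Icc hθ
  have h2 : √2 ^ 2 = 2 := sq_sqrt zero_le_two
  have hsqrt : √(2 - (√2 * cos θ) ^ 2) = √2 * sin θ := by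
    rw [← sqrt_sq (by positivity : 0 ≤ √2 * sin θ)]
    congr 1
    rw [mul_pow, mul_pow, h2, sin_sq]
    ring
  simp only [smul_eq_mul, hsqrt]
  rw [mul_neg, abs_neg, abs_of_nonneg (by positivity)]
  linear_combination (sin θ ^ 2 * log |x - √2 * cos θ| / π) * h2

lemma log_abs_sub_sqrt_two_mul_cos {x : ℝ} {w : ℂ} (hw : w ≠ 0)
    (hx : w ^ 2 + 1 = √2 * x * w) {θ : ℝ} (h1 : circleMap 0 1 θ - w ≠ 0)
    (h2 : circleMap 0 1 (-θ) - w ≠ 0) :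
    log |x - √2 * cos θ| = log ‖circleMap 0 1 θ - w‖ + log ‖circleMap 0 1 (-θ) - w‖
      - (log 2 / 2 + log ‖w‖) := by
  have h0 : √2 ≠ 0 := by positivity
  have hnw := norm_ne_zero_iff.mpr hw
  have hprod : (circleMap 0 1 θ - w) * (circleMap 0 1 (-θ) - w)
      = ((√2 : ℝ) : ℂ) * w * ((x - √2 * cos θ : ℝ) : ℂ) := by
    have hs : ((√2 : ℝ) : ℂ) ^ 2 = 2 := by exact_mod_cast sq_sqrt (zero_le_two (α := ℝ))
    simp only [circleMap, Complex.exp_mul_I, Complex.ofReal_neg, Complex.cos_neg, Complex.sin_neg]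
    push_cast
    linear_combination hx + Complex.sin_sq_add_cos_sq θ - Complex.sin θ ^ 2 * Complex.I_sq
      + w * Complex.cos θ * hs
  have hne : x - √2 * cos θ ≠ 0 := by
    intro h
    rw [h] at hprod
    exact mul_ne_zero h1 h2 (by simpa using hprod)
  have hnorm := congrArg (fun z ↦ log ‖z‖) hprod
  simp only [norm_mul, Complex.norm_real, Real.norm_eq_abs, abs_of_nonneg (sqrt_nonneg 2)] at hnorm
  rw [Real.log_mul (norm_ne_zero_iff.mpr h1) (norm_ne_zero_iff.mpr h2),
    Real.log_mul (mul_ne_zero h0 hnw) (abs_ne_zero.mpr hne), Real.log_mul h0 hnw,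
    Real.log_sqrt zero_le_two] at hnorm
  linarith

lemma integral_log_abs_sub_semicircle {x : ℝ} {w : ℂ} (hw : 1 ≤ ‖w‖)
    (hx : w ^ 2 + 1 = √2 * x * w) :
    ∫ t in Set.Icc (-√2) (√2), log |x - t| * (√(2 - t ^ 2) / π)
      = log ‖w‖ + (w⁻¹ ^ 2).re / 2 - log 2 / 2 := by
  have hw0 : w ≠ 0 := norm_pos_iff.mp (by linarith)
  set g : ℝ → ℝ := fun θ ↦ log ‖circleMap 0 1 θ - w‖ * sin θ ^ 2 with hg
  have hgi : ∀ a b, IntervalIntegrable g volume a b :=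
    intervalIntegrable_log_norm_circleMap_sub_mul_sin_sq w
  have hrefl : (fun θ ↦ g (-θ)) = fun θ ↦ g (2 * π - θ) := by
    ext θ
    have : circleMap 0 1 (2 * π - θ) = circleMap 0 1 (-θ) := by
      rw [← periodic_circleMap 0 1 (-θ)]
      congr 1
      ring
    simp [hg, this]
  have hgi' : IntervalIntegrable (fun θ ↦ g (-θ)) volume 0 π := by
    rw [hrefl]
    simpa using (hgi (2 * π) (2 * π - π)).comp_sub_left (2 * π)
  have hsum : (∫ θ in 0..π, g θ) + ∫ θ in 0..π, g (-θ) = ∫ θ in 0..2 * π, g θ := by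
    rw [hrefl, intervalIntegral.integral_comp_sub_left, sub_zero,
      show 2 * π - π = π by ring, intervalIntegral.integral_add_adjacent_intervals (hgi _ _) (hgi _ _)]
  have hsin : IntervalIntegrable (fun θ ↦ (log 2 / 2 + log ‖w‖) * sin θ ^ 2) volume 0 π :=
    Continuous.intervalIntegrable (by fun_prop) _ _
  have hneg : ∀ᵐ θ : ℝ, circleMap 0 1 (-θ) - w ≠ 0 :=
    (Measure.measurePreserving_neg (volume : Measure ℝ)).quasiMeasurePreserving.ae
      (ae_circleMap_sub_ne_zero w)
  have hcongr : ∫ θ in 0..π, log |x - √2 * cos θ| * sin θ ^ 2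
      = ∫ θ in 0..π, (g θ + g (-θ) - (log 2 / 2 + log ‖w‖) * sin θ ^ 2) := by
    apply intervalIntegral.integral_congr_ae
    filter_upwards [ae_circleMap_sub_ne_zero w, hneg] with θ h1 h2 _
    rw [log_abs_sub_sqrt_two_mul_cos hw0 hx h1 h2]
    simp only [hg, sin_neg]
    ring
  rw [integral_log_abs_sub_semicircle_eq_integral_cos, intervalIntegral.integral_const_mul, hcongr,
    intervalIntegral.integral_sub ((hgi _ _).add hgi') hsin,
    intervalIntegral.integral_add (hgi _ _) hgi', hsum, intervalIntegral.integral_const_mul,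
    integral_log_norm_circleMap_sub_mul_sin_sq hw, integral_sin_sq]
  simp only [sin_zero, sin_pi]
  field_simp
  ring

lemma integral_log_abs_sub_semicircle_of_abs_le {x : ℝ} (hx : |x| ≤ √2) :
    ∫ t in Set.Icc (-√2) (√2), log |x - t| * (√(2 - t ^ 2) / π)
      = x ^ 2 / 2 - 1 / 2 - log 2 / 2 := by
  obtain ⟨φ, -, rfl⟩ : x ∈ (fun θ ↦ √2 * cos θ) '' Set.Icc 0 π := by
    rw [image_sqrt_two_mul_cos]
    exact abs_le.mp hx
  have hs : √2 ^ 2 = 2 := sq_sqrt zero_le_two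
  have hexp : Complex.exp (φ * Complex.I) = Complex.cos φ + Complex.sin φ * Complex.I :=
    Complex.exp_mul_I φ
  have hinv : (Complex.exp (φ * Complex.I))⁻¹ = Complex.cos φ - Complex.sin φ * Complex.I := by
    rw [← Complex.exp_neg, ← neg_mul, Complex.exp_mul_I, Complex.cos_neg, Complex.sin_neg]
    ring
  have hre : ((Complex.exp (φ * Complex.I))⁻¹ ^ 2).re = 2 * cos φ ^ 2 - 1 := by
    have : (Complex.exp (φ * Complex.I))⁻¹ ^ 2
        = ((2 * cos φ ^ 2 - 1 : ℝ) : ℂ) + ((-2 * cos φ * sin φ : ℝ) : ℂ) * Complex.I := by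
      rw [hinv]
      push_cast
      linear_combination -Complex.sin_sq_add_cos_sq φ + Complex.sin φ ^ 2 * Complex.I_sq
    rw [this, Complex.add_re, Complex.ofReal_re, Complex.re_ofReal_mul, Complex.I_re]
    ring
  rw [integral_log_abs_sub_semicircle (w := Complex.exp (φ * Complex.I)) (by simp), hre]
  · simp only [Complex.norm_exp_ofReal_mul_I, log_one]
    linear_combination (-cos φ ^ 2 / 2) * hs
  · have hs' : ((√2 : ℝ) : ℂ) ^ 2 = 2 := by exact_mod_cast hs
    rw [hexp]
    push_cast
    linear_combination -Complex.sin_sq_add_cos_sq φ + Complex.sin φ ^ 2 * Complex.I_sq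
      - Complex.cos φ * (Complex.cos φ + Complex.sin φ * Complex.I) * hs'

lemma integral_log_abs_sub_semicircle_of_lt_abs {x : ℝ} (hx : √2 < |x|) :
    ∫ t in Set.Icc (-√2) (√2), log |x - t| * (√(2 - t ^ 2) / π)
      = x ^ 2 / 2 - 1 / 2 - log 2 - (|x| / 2) * √(x ^ 2 - 2) + log (|x| + √(x ^ 2 - 2)) := by
  have hs : √2 ^ 2 = 2 := sq_sqrt zero_le_two
  have hs0 : 0 < √2 := by positivity
  have hx2 : 2 ≤ x ^ 2 := by
    rw [← sq_abs, ← hs]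
    gcongr
  set r := √(x ^ 2 - 2) with hr
  have hr2 : r ^ 2 = x ^ 2 - 2 := sq_sqrt (by linarith)
  have hr0 : 0 ≤ r := sqrt_nonneg _
  have hx0 : 0 < |x| := hs0.trans hx
  obtain ⟨e, he, hex⟩ : ∃ e : ℝ, e ^ 2 = 1 ∧ x = e * |x| := by
    rcases abs_cases x with ⟨h, -⟩ | ⟨h, -⟩
    · exact ⟨1, by norm_num, by rw [h]; ring⟩
    · exact ⟨-1, by norm_num, by rw [h]; ring⟩
  have heabs : |e| = 1 := by
    rw [← sqrt_sq_eq_abs, he, sqrt_one]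
  set u : ℝ := (|x| + r) / √2 with hu
  have hu1 : 1 ≤ u := by
    rw [hu, one_le_div hs0]
    linarith
  have hu0 : u ≠ 0 := by positivity
  have hnorm : ‖((e * u : ℝ) : ℂ)‖ = u := by
    rw [Complex.norm_real, Real.norm_eq_abs, abs_mul, heabs, one_mul, abs_of_nonneg (by linarith)]
  have hxr : (|x| + r) * (|x| - r) = 2 := by
    linear_combination sq_abs x - hr2
  have hinv : (e * u)⁻¹ ^ 2 = x ^ 2 - 1 - |x| * r := by
    have : u⁻¹ = (|x| - r) / √2 := by
      apply inv_eq_of_mul_eq_one_right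
      rw [hu]
      field_simp
      rw [hxr, hs]
    rw [mul_inv, mul_pow, inv_pow, he, this, div_pow, hs]
    linear_combination sq_abs x / 2 + hr2 / 2
  have hre : (((e * u : ℝ) : ℂ)⁻¹ ^ 2).re = x ^ 2 - 1 - |x| * r := by
    rw [← hinv]
    norm_cast
  rw [integral_log_abs_sub_semicircle (w := ((e * u : ℝ) : ℂ)) (by rwa [hnorm]), hnorm, hre, hu,
    Real.log_div (by positivity) hs0.ne', Real.log_sqrt zero_le_two]
  · ring
  · have : (e * u) ^ 2 + 1 = √2 * x * (e * u) := by
      have hsu : √2 * u = |x| + r := by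
        rw [hu]
        field_simp
      have h2 : √2 * x * (e * u) = |x| * (|x| + r) := by
        rw [← hsu]
        nth_rewrite 1 [hex]
        linear_combination (√2 * |x| * u) * he
      have h3 : 2 * u ^ 2 = (|x| + r) ^ 2 := by
        rw [← hsu, mul_pow, hs]
      rw [h2]
      linear_combination u ^ 2 * he + h3 / 2 + hr2 / 2 - sq_abs x / 2
    exact_mod_cast this

lemma log_add_sqrt_le {a : ℝ} (ha : √2 < a) :
    log (a + √(a ^ 2 - 2)) ≤ a / 2 * √(a ^ 2 - 2) + log 2 / 2 := by
  have ha0 : 0 < a := (sqrt_nonneg 2).trans_lt ha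
  have ha2 : 2 ≤ a ^ 2 := by
    rw [← sq_sqrt (zero_le_two (α := ℝ))]
    gcongr
  set r := √(a ^ 2 - 2) with hr
  have hr2 : r ^ 2 = a ^ 2 - 2 := sq_sqrt (by linarith)
  have hr0 : 0 ≤ r := sqrt_nonneg _
  set v := (a + r) ^ 2 / 2 with hv
  have hv0 : 0 < v := by positivity
  have hlogv : log v = 2 * log (a + r) - log 2 := by
    rw [hv, Real.log_div (by positivity) two_ne_zero, Real.log_pow]
    norm_num
  have hvinv : v⁻¹ = (a - r) ^ 2 / 2 := by
    apply inv_eq_of_mul_eq_one_right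
    rw [hv]
    have : (a + r) * (a - r) = 2 := by linear_combination -hr2
    linear_combination ((a + r) * (a - r) + 2) / 4 * this
  have hv1 : 1 ≤ v := by
    rw [hv]
    nlinarith [mul_nonneg ha0.le hr0]
  have h := Real.self_le_sinh_iff.mpr (Real.log_nonneg hv1)
  rw [Real.sinh_log hv0, hvinv, hlogv] at h
  nlinarith

/-- For the semicircle law `σ_sc` on `[−√2, √2]` with density `√(2−t²)/π`, the logarithmic
potential `Ψ*(x) = ∫ log|x−t| σ_sc(dt)` satisfies
`Ψ*(x) = x²/2 − 1/2 − (log 2)/2` for `|x| ≤ √2`,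
`Ψ*(x) = x²/2 − 1/2 − log 2 − (|x|/2)√(x²−2) + log(|x| + √(x²−2))` for `|x| > √2`,
and `Ψ*(x) − x²/2 ≤ −1/2 − (log 2)/2` for all `x`. -/
theorem stmt13 :
    (∀ x : ℝ, |x| ≤ Real.sqrt 2 →
      (∫ t in Set.Icc (-Real.sqrt 2) (Real.sqrt 2),
          Real.log |x - t| * (Real.sqrt (2 - t ^ 2) / Real.pi))
        = x ^ 2 / 2 - 1 / 2 - Real.log 2 / 2) ∧
    (∀ x : ℝ, Real.sqrt 2 < |x| →
      (∫ t in Set.Icc (-Real.sqrt 2) (Real.sqrt 2),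
          Real.log |x - t| * (Real.sqrt (2 - t ^ 2) / Real.pi))
        = x ^ 2 / 2 - 1 / 2 - Real.log 2 - (|x| / 2) * Real.sqrt (x ^ 2 - 2) +
            Real.log (|x| + Real.sqrt (x ^ 2 - 2))) ∧
    ∀ x : ℝ,
      (∫ t in Set.Icc (-Real.sqrt 2) (Real.sqrt 2),
          Real.log |x - t| * (Real.sqrt (2 - t ^ 2) / Real.pi)) - x ^ 2 / 2
        ≤ -(1 / 2) - Real.log 2 / 2 := by
  refine ⟨fun x hx ↦ integral_log_abs_sub_semicircle_of_abs_le hx,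
    fun x hx ↦ integral_log_abs_sub_semicircle_of_lt_abs hx, fun x ↦ ?_⟩
  rcases le_or_gt |x| (√2) with hx | hx
  · rw [integral_log_abs_sub_semicircle_of_abs_le hx]
    linarith
  · rw [integral_log_abs_sub_semicircle_of_lt_abs hx]
    have h := log_add_sqrt_le hx
    rw [sq_abs] at h
    linarith
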